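/- Let 𝕀 = (I, ≤, 𝓘) be a set of indices, let 𝓑, 𝒵 be asymptotic gauges on 𝕀, and let Ω ⊆ ℝⁿ be an open set. Then ℰ_M(𝓑,Ω) = ℰ_M(ℝ_M(𝓑),Ω) and 𝒩(𝒵,Ω) = 𝒩(ℝ_M(𝒵),Ω), where the moderateness and negligibility conditions on the right-hand sides are taken with respect to the asymptotic gauge ℝ_M(𝓑) (respectively ℝ_M(𝒵), with (ℝ_M(𝒵))_{>0} in place of 𝒵_{>0}). -/

import Mathlib

open MeasureTheory

/-- Strict order relation used in the paper: `x < y` iff `x ≤ y` and `x ≠ y`. -/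
def sLT {I : Type*} [Preorder I] (x y : I) : Prop := x ≤ y ∧ x ≠ y

/-- A set of indices `𝕀 = (I, ≤, 𝓘)` in the sense of Giordano–Luperi Baglini. -/
structure SetOfIndices (I : Type*) [Preorder I] where
  sets : Set (Set I)
  empty_not_mem : (∅ : Set I) ∉ sets
  univ_mem : (Set.univ : Set I) ∈ sets
  inter_sub : ∀ A ∈ sets, ∀ B ∈ sets, ∃ C ∈ sets, C ⊆ A ∩ B
  downward : ∀ A ∈ sets, ∀ a ∈ A, ∀ e, e ≤ a →
    ((∃ ε, ε ∈ A ∧ ε ≤ e) ∧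
      (∀ b ∈ A, b ≤ e → ∀ c ∈ A, c ≤ e →
        ∃ d, d ∈ A ∧ d ≤ e ∧ sLT d b ∧ sLT d c))

section Defs

variable {I : Type*} [Preorder I]

/-- `x = O_{a,A}(y)`. -/
def BigOaA (A : Set I) (a : I) (x y : I → ℝ) : Prop :=
  ∃ H : ℝ, 0 < H ∧ ∃ ε₀, ε₀ ∈ A ∧ ε₀ ≤ a ∧ ∀ ε ∈ A, ε ≤ ε₀ → |x ε| ≤ H * |y ε|

/-- `x = O_𝒥(y)` for a family `𝒥` of subsets of `I`. -/
def BigOJ (J : Set (Set I)) (x y : I → ℝ) : Prop :=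
  ∃ A ∈ J, ∀ a ∈ A, BigOaA A a x y

/-- `x = O(y)` (i.e. `O_𝓘`). -/
def BigO (S : SetOfIndices I) (x y : I → ℝ) : Prop := BigOJ S.sets x y

/-- `i >_𝕀 j`. -/
def gtI (S : SetOfIndices I) (i j : I → ℝ) : Prop :=
  ∃ A ∈ S.sets, ∀ a ∈ A, ∃ e, e ∈ A ∧ e ≤ a ∧ ∀ ε ∈ A, ε ≤ e → j ε < i ε

/-- `P(ε)` holds for `ε` sufficiently small in `𝕀`. -/
def EventuallyI (S : SetOfIndices I) (P : I → Prop) : Prop :=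
  ∃ A ∈ S.sets, ∀ a ∈ A, ∃ e, e ∈ A ∧ e ≤ a ∧ ∀ ε ∈ A, ε ≤ e → P ε

/-- `lim_𝕀 f = l` for a finite limit `l ∈ ℝ`. -/
def limEq (S : SetOfIndices I) (f : I → ℝ) (l : ℝ) : Prop :=
  ∃ A ∈ S.sets, ∀ a ∈ A, ∀ r : ℝ, 0 < r →
    ∃ a₀, a₀ ≤ a ∧ ∀ ε ∈ A, ε ≤ a₀ → |l - f ε| < r

/-- `lim_𝕀 f = ∞` (unsigned infinity). -/
def limInfinite (S : SetOfIndices I) (f : I → ℝ) : Prop :=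
  ∃ A ∈ S.sets, ∀ a ∈ A, ∀ R : ℝ, 0 < R →
    ∃ a₀, a₀ ≤ a ∧ ∀ ε ∈ A, ε ≤ a₀ → R < |f ε|

/-- `lim_𝕀 f = +∞`. -/
def limPInf (S : SetOfIndices I) (f : I → ℝ) : Prop :=
  ∃ A ∈ S.sets, ∀ a ∈ A, ∀ R : ℝ, 0 < R →
    ∃ a₀, a₀ ≤ a ∧ ∀ ε ∈ A, ε ≤ a₀ → R < f ε

/-- `𝓑` is an asymptotic gauge on the set of indices `S`. -/
structure IsAG (S : SetOfIndices I) (B : Set (I → ℝ)) : Prop where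
  infinite : ∃ i ∈ B, limInfinite S i
  mul : ∀ i ∈ B, ∀ j ∈ B, ∃ p ∈ B, BigO S (fun ε => i ε * j ε) p
  smul : ∀ i ∈ B, ∀ r : ℝ, ∃ σ ∈ B, BigO S (fun ε => r * i ε) σ
  absAdd : ∀ i ∈ B, ∀ j ∈ B, ∃ s ∈ B, gtI S s (fun _ => 0) ∧
    BigO S (fun ε => |i ε| + |j ε|) s

/-- `𝓑_{>0}`, the positive part of `𝓑`. -/
def agPos (S : SetOfIndices I) (B : Set (I → ℝ)) : Set (I → ℝ) :=
  {i ∈ B | gtI S i (fun _ => 0)}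

/-- `ℝ_M(𝓑)`, the moderate nets generated by `𝓑`. -/
def RM (S : SetOfIndices I) (B : Set (I → ℝ)) : Set (I → ℝ) :=
  {x | ∃ b ∈ B, BigO S x b}

/-- `sup_{x ∈ K} |f x|`. -/
noncomputable def supAbsOn {X : Type*} (K : Set X) (f : X → ℝ) : ℝ :=
  sSup ((fun x => |f x|) '' K)

/-- Partial derivative of `f : ℝⁿ → ℝ` in the `i`-th coordinate direction. -/
noncomputable def pDeriv {n : ℕ} (i : Fin n) (f : (Fin n → ℝ) → ℝ) :
    (Fin n → ℝ) → ℝ :=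
  fun x => fderiv ℝ f x (Pi.single i 1)

/-- Iterated partial derivative `∂^α f` along a list of coordinate directions
(the list encodes the multi-index `α ∈ ℕⁿ`). -/
noncomputable def multiDeriv {n : ℕ} : List (Fin n) → ((Fin n → ℝ) → ℝ) → ((Fin n → ℝ) → ℝ)
  | [], f => f
  | i :: l, f => multiDeriv l (pDeriv i f)

/-- `ℰ_M(𝓑,Ω)`: the `𝓑`-moderate nets of smooth functions on `Ω ⊆ ℝⁿ`. -/
def EMod (S : SetOfIndices I) (B : Set (I → ℝ)) {n : ℕ} (Ω : Set (Fin n → ℝ))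
    (u : I → (Fin n → ℝ) → ℝ) : Prop :=
  ∀ K : Set (Fin n → ℝ), K ⊆ Ω → IsCompact K → ∀ l : List (Fin n),
    ∃ b ∈ B, BigO S (fun ε => supAbsOn K (multiDeriv l (u ε))) b

/-- `𝒩(𝒵,Ω)`: the `𝒵`-negligible nets of smooth functions on `Ω ⊆ ℝⁿ`. -/
def NNeg (S : SetOfIndices I) (Z : Set (I → ℝ)) {n : ℕ} (Ω : Set (Fin n → ℝ))
    (u : I → (Fin n → ℝ) → ℝ) : Prop :=
  ∀ K : Set (Fin n → ℝ), K ⊆ Ω → IsCompact K → ∀ l : List (Fin n),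
    ∀ z ∈ agPos S Z,
      BigO S (fun ε => supAbsOn K (multiDeriv l (u ε))) (fun ε => (z ε)⁻¹)

/-- One–dimensional version of `ℰ_M(𝓑,ℝ)`, using iterated derivatives. -/
def EM1 (S : SetOfIndices I) (B : Set (I → ℝ)) (u : I → ℝ → ℝ) : Prop :=
  ∀ K : Set ℝ, IsCompact K → ∀ k : ℕ,
    ∃ b ∈ B, BigO S (fun ε => supAbsOn K (iteratedDeriv k (u ε))) b

/-- One–dimensional version of `𝒩(𝒵,ℝ)`, using iterated derivatives. -/
def NEG1 (S : SetOfIndices I) (Z : Set (I → ℝ)) (u : I → ℝ → ℝ) : Prop :=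
  ∀ K : Set ℝ, IsCompact K → ∀ k : ℕ, ∀ z ∈ agPos S Z,
    BigO S (fun ε => supAbsOn K (iteratedDeriv k (u ε))) (fun ε => (z ε)⁻¹)

/-- `AG(b) = {b^m ∣ m ∈ ℕ}`, the principal asymptotic gauge generated by `b`. -/
def AGpow (b : I → ℝ) : Set (I → ℝ) := {g | ∃ m : ℕ, g = fun ε => (b ε) ^ m}

/-- `e^𝓑 = {e^{H·b} ∣ H > 0, b ∈ 𝓑}`, the exponential of the asymptotic gauge `𝓑`. -/
def expAG (B : Set (I → ℝ)) : Set (I → ℝ) :=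
  {g | ∃ H : ℝ, 0 < H ∧ ∃ b ∈ B, g = fun ε => Real.exp (H * b ε)}

end Defs

/-- Two eventual bounds with constants hold simultaneously for small indices of a common set. -/
theorem SetOfIndices.eventual_and {I : Type*} [Preorder I] (S : SetOfIndices I)
    {P Q : ℝ → I → Prop}
    (hP : ∃ A ∈ S.sets, ∀ a ∈ A, ∃ H : ℝ, 0 < H ∧ ∃ e, e ∈ A ∧ e ≤ a ∧ ∀ ε ∈ A, ε ≤ e → P H ε)
    (hQ : ∃ A ∈ S.sets, ∀ a ∈ A, ∃ H : ℝ, 0 < H ∧ ∃ e, e ∈ A ∧ e ≤ a ∧ ∀ ε ∈ A, ε ≤ e → Q H ε) :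
    ∃ A ∈ S.sets, ∀ a ∈ A, ∃ H : ℝ, 0 < H ∧ ∃ K : ℝ, 0 < K ∧
      ∃ e, e ∈ A ∧ e ≤ a ∧ ∀ ε ∈ A, ε ≤ e → P H ε ∧ Q K ε := by
  obtain ⟨A, hA, hP⟩ := hP
  obtain ⟨B, hB, hQ⟩ := hQ
  obtain ⟨C, hC, hCAB⟩ := S.inter_sub A hA B hB
  refine ⟨C, hC, fun a ha => ?_⟩
  obtain ⟨H, hH, e, -, hea, hPe⟩ := hP a (hCAB ha).1
  obtain ⟨c, hc, hce⟩ := (S.downward C hC a ha e hea).1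
  obtain ⟨K, hK, f, -, hfc, hQf⟩ := hQ c (hCAB hc).2
  obtain ⟨d, hd, hdf⟩ := (S.downward C hC c hc f hfc).1
  exact ⟨H, hH, K, hK, d, hd, hdf.trans (hfc.trans (hce.trans hea)), fun ε hε hεd =>
    ⟨hPe ε (hCAB hε).1 (hεd.trans (hdf.trans (hfc.trans hce))),
      hQf ε (hCAB hε).2 (hεd.trans hdf)⟩⟩

theorem BigO.of_abs_le {I : Type*} [Preorder I] {S : SetOfIndices I} {x y : I → ℝ}
    (h : ∀ ε, |x ε| ≤ |y ε|) : BigO S x y :=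
  ⟨Set.univ, S.univ_mem, fun a ha =>
    ⟨1, one_pos, a, ha, le_rfl, fun ε _ _ => by simpa using h ε⟩⟩

theorem BigO.trans {I : Type*} [Preorder I] {S : SetOfIndices I} {x y z : I → ℝ}
    (hxy : BigO S x y) (hyz : BigO S y z) : BigO S x z := by
  obtain ⟨A, hA, h⟩ := S.eventual_and (P := fun H ε => |x ε| ≤ H * |y ε|)
    (Q := fun H ε => |y ε| ≤ H * |z ε|) hxy hyz
  refine ⟨A, hA, fun a ha => ?_⟩
  obtain ⟨H, hH, K, hK, e, he, hea, h⟩ := h a ha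
  refine ⟨H * K, mul_pos hH hK, e, he, hea, fun ε hε hεe => ?_⟩
  obtain ⟨h₁, h₂⟩ := h ε hε hεe
  calc |x ε| ≤ H * |y ε| := h₁
    _ ≤ H * (K * |z ε|) := by gcongr
    _ = H * K * |z ε| := (mul_assoc _ _ _).symm

/-- Inversion reverses `O` when the smaller net is eventually positive. -/
theorem BigO.inv {I : Type*} [Preorder I] {S : SetOfIndices I} {x y : I → ℝ}
    (hxy : BigO S x y) (hx : gtI S x (fun _ => 0)) :
    BigO S (fun ε => (y ε)⁻¹) (fun ε => (x ε)⁻¹) := by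
  obtain ⟨B, hB, hx⟩ := hx
  obtain ⟨A, hA, h⟩ := S.eventual_and (P := fun H ε => |x ε| ≤ H * |y ε|)
    (Q := fun _ ε => 0 < x ε) hxy ⟨B, hB, fun a ha => ⟨1, one_pos, hx a ha⟩⟩
  refine ⟨A, hA, fun a ha => ?_⟩
  obtain ⟨H, hH, -, -, e, he, hea, h⟩ := h a ha
  refine ⟨H, hH, e, he, hea, fun ε hε hεe => ?_⟩
  obtain ⟨h₁, h₂⟩ := h ε hε hεe
  have hxpos : 0 < |x ε| := abs_pos.mpr h₂.ne'
  have hypos : 0 < |y ε| := pos_of_mul_pos_right (hxpos.trans_le h₁) hH.le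
  rw [abs_inv, abs_inv, ← div_eq_mul_inv, le_div_iff₀ hxpos, inv_mul_le_iff₀ hypos, mul_comm]
  exact h₁

theorem subset_RM {I : Type*} [Preorder I] (S : SetOfIndices I) (B : Set (I → ℝ)) :
    B ⊆ RM S B :=
  fun b hb => ⟨b, hb, .of_abs_le fun _ => le_rfl⟩

/-- Every moderate net is dominated by a positive element of the gauge. -/
theorem IsAG.exists_agPos_bigO {I : Type*} [Preorder I] {S : SetOfIndices I} {B : Set (I → ℝ)}
    (hB : IsAG S B) {x : I → ℝ} (hx : x ∈ RM S B) : ∃ s ∈ agPos S B, BigO S x s := by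
  obtain ⟨b, hb, hxb⟩ := hx
  obtain ⟨s, hs, hspos, hbs⟩ := hB.absAdd b hb b hb
  refine ⟨s, ⟨hs, hspos⟩, hxb.trans (.trans (.of_abs_le fun ε => ?_) hbs)⟩
  exact (le_add_of_nonneg_right (abs_nonneg _)).trans (le_abs_self _)

/-- equivalent asymptotic gauges give the same moderate and
negligible nets: `ℰ_M(𝓑,Ω) = ℰ_M(ℝ_M(𝓑),Ω)` and `𝒩(𝒵,Ω) = 𝒩(ℝ_M(𝒵),Ω)`
(Thm. `ograndi` of the paper). -/
theorem moderate_negligible_RM {I : Type*} [Preorder I] (S : SetOfIndices I)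
    {n : ℕ} (B Z : Set (I → ℝ)) (hB : IsAG S B) (hZ : IsAG S Z)
    (Ω : Set (Fin n → ℝ)) (hΩ : IsOpen Ω)
    (u : I → (Fin n → ℝ) → ℝ) (hu : ∀ ε, ContDiffOn ℝ (⊤ : ℕ∞) (u ε) Ω) :
    (EMod S B Ω u ↔ EMod S (RM S B) Ω u) ∧
    (NNeg S Z Ω u ↔ NNeg S (RM S Z) Ω u) := by
  constructor
  · constructor
    · intro h K hK hKc l
      obtain ⟨b, hb, hub⟩ := h K hK hKc l
      exact ⟨b, subset_RM S B hb, hub⟩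
    · intro h K hK hKc l
      obtain ⟨x, ⟨b, hb, hxb⟩, hux⟩ := h K hK hKc l
      exact ⟨b, hb, hux.trans hxb⟩
  · constructor
    · rintro h K hK hKc l z ⟨hz, hzpos⟩
      obtain ⟨s, hs, hzs⟩ := hZ.exists_agPos_bigO hz
      exact (h K hK hKc l s hs).trans (hzs.inv hzpos)
    · rintro h K hK hKc l z ⟨hz, hzpos⟩
      exact h K hK hKc l z ⟨subset_RM S Z hz, hzpos⟩
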